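/- Let 𝒯=(V,ℰ) be a leafless, locally finite rooted directed tree, q ≥ 1 a real number, S_{λ,q} the Dirichlet shift on ℓ²(V), and S'_{λ,q} = S_{λ,q}(S_{λ,q}*S_{λ,q})^{-1} its Cauchy dual. Then for every k ∈ ℕ and every v ∈ V, ‖S_{λ,q}^k e_v‖² = (n_v+q)_k/(n_v+1)_k and ‖(S'_{λ,q})^k e_v‖² = (n_v+1)_k/(n_v+q)_k. -/

import Mathlib

open scoped ENNReal InnerProductSpace
open ContinuousLinearMap

noncomputable section

/-- A (countably infinite) rooted directed tree. -/
structure DirTree (V : Type) where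
  edge : V → V → Prop
  not_self : ∀ v, ¬ edge v v
  no_circuit : ∀ v, ¬ Relation.TransGen edge v v
  connected : ∀ u v : V, Relation.ReflTransGen (fun a b => edge a b ∨ edge b a) u v
  uniq_parent : ∀ {u w v : V}, edge u v → edge w v → u = w
  root : V
  root_no_parent : ∀ u, ¬ edge u root
  root_uniq : ∀ v, (∀ u, ¬ edge u v) → v = root

namespace DirTree

variable {V : Type} (T : DirTree V)

/-- The set of children of a vertex. -/
def chi (v : V) : Set V := {u | T.edge v u}

/-- Leafless: every vertex has a child. -/
def Leafless : Prop := ∀ v : V, ∃ u, T.edge v u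

/-- Locally finite: every vertex has finitely many children. -/
def LocFin : Prop := ∀ v : V, (T.chi v).Finite

/-- The finset of children of a vertex (locally finite case). -/
def chiFin (hT : T.LocFin) (v : V) : Finset V := (hT v).toFinset

/-- Iterated child sets `Chi^⟨n⟩(W)`. -/
def chiIter (T : DirTree V) : ℕ → Set V → Set V
  | 0, W => W
  | n + 1, W => {u | ∃ v ∈ chiIter T n W, T.edge v u}

/-- The depth of a vertex: the unique `n` with `v ∈ Chi^⟨n⟩(root)`. -/
def depth (v : V) : ℕ := sInf {n | v ∈ T.chiIter n {T.root}}

/-- The parent map (junk value at the root). -/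
def par (v : V) : V :=
  letI := Classical.propDecidable (∃ u, T.edge u v)
  if h : ∃ u, T.edge u v then h.choose else v

end DirTree

/-- `ℓ²(V)`. -/
abbrev l2 (V : Type) := lp (fun _ : V => ℂ) 2

/-- The standard orthonormal basis vector `e_v` of `ℓ²(V)`. -/
def evec {V : Type} (v : V) : l2 V :=
  letI := Classical.decEq V
  lp.single 2 v 1

/-- The Pochhammer symbol `(x)_k = x (x+1) ⋯ (x+k-1)`. -/
def poch (x : ℝ) (k : ℕ) : ℝ := ∏ i ∈ Finset.range k, (x + i)

namespace DirTree

variable {V : Type} (T : DirTree V)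

/-- The weight `λ_{u,q}` (for any child `u` of `v`). -/
def wt (hT : T.LocFin) (q : ℝ) (v : V) : ℝ :=
  Real.sqrt (((T.depth v : ℝ) + q) / ((T.depth v : ℝ) + 1)) /
    Real.sqrt ((T.chiFin hT v).card)

/-- `S` is the Dirichlet shift with parameter `q` on `ℓ²(V)`:
`S e_v = ∑_{u ∈ Chi(v)} λ_{u,q} e_u`. -/
def IsDirichletShift (hT : T.LocFin) (q : ℝ) (S : l2 V →L[ℂ] l2 V) : Prop :=
  ∀ v : V, S (evec v) = ∑ u ∈ T.chiFin hT v, ((T.wt hT q v : ℝ) : ℂ) • evec u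

end DirTree

/-- The Cauchy dual `S (S*S)⁻¹` of a left-invertible operator. -/
def cauchyDual {V : Type} (S : l2 V →L[ℂ] l2 V) : l2 V →L[ℂ] l2 V :=
  S * Ring.inverse (ContinuousLinearMap.adjoint S * S)

namespace DirTree

variable {V : Type} (T : DirTree V)

theorem mem_chiFin (hT : T.LocFin) {u v : V} : u ∈ T.chiFin hT v ↔ T.edge v u := by
  simp [chiFin, chi]

theorem exists_mem_chiIter (v : V) : ∃ n, v ∈ T.chiIter n {T.root} := by
  induction T.connected T.root v with
  | refl => exact ⟨0, rfl⟩
  | @tail b c _ h ih =>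
    obtain ⟨n, hn⟩ := ih
    rcases h with h | h
    · exact ⟨n + 1, b, hn, h⟩
    · cases n with
      | zero =>
        obtain rfl : b = T.root := hn
        exact absurd h (T.root_no_parent _)
      | succ n =>
        obtain ⟨w, hw, hwb⟩ := hn
        obtain rfl := T.uniq_parent h hwb
        exact ⟨n, hw⟩

theorem chiIter_index_unique {m n : ℕ} {v : V} (hm : v ∈ T.chiIter m {T.root})
    (hn : v ∈ T.chiIter n {T.root}) : m = n := by
  induction m generalizing n v with
  | zero =>
    cases n with
    | zero => rfl
    | succ n =>
      obtain rfl : v = T.root := hm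
      obtain ⟨w, _, hw⟩ := hn
      exact absurd hw (T.root_no_parent _)
  | succ m ih =>
    obtain ⟨w, hw, hwv⟩ := hm
    cases n with
    | zero =>
      obtain rfl : v = T.root := hn
      exact absurd hwv (T.root_no_parent _)
    | succ n =>
      obtain ⟨w', hw', hwv'⟩ := hn
      obtain rfl := T.uniq_parent hwv hwv'
      rw [ih hw hw']

theorem depth_of_edge {u v : V} (h : T.edge v u) : T.depth u = T.depth v + 1 :=
  T.chiIter_index_unique (Nat.sInf_mem (T.exists_mem_chiIter u))
    ⟨v, Nat.sInf_mem (T.exists_mem_chiIter v), h⟩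

end DirTree

theorem inner_evec_left {V : Type} (v : V) (x : l2 V) : ⟪evec v, x⟫_ℂ = x v := by
  simp [evec, lp.inner_single_left]

open Classical in
theorem inner_evec_evec {V : Type} (u v : V) :
    ⟪evec u, evec v⟫_ℂ = if u = v then 1 else 0 := by
  rw [inner_evec_left]
  simp [evec, lp.single_apply, Pi.single_apply]

namespace DirTree

variable {V : Type} (T : DirTree V)

open Classical in
/-- Powers of a weighted shift whose squared norms at the basis vectors depend only on the depth
send distinct basis vectors to orthogonal vectors, with multiplicative squared norms. -/
theorem inner_shift_pow_evec (hT : T.LocFin) {A : l2 V →L[ℂ] l2 V} {w : V → ℝ} {f : ℕ → ℝ}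
    (hA : ∀ v, A (evec v) = ∑ u ∈ T.chiFin hT v, (w v : ℂ) • evec u)
    (hw : ∀ v, (T.chiFin hT v).card * w v ^ 2 = f (T.depth v)) (k : ℕ) (u v : V) :
    ⟪(A ^ k) (evec u), (A ^ k) (evec v)⟫_ℂ =
      if u = v then ((∏ i ∈ Finset.range k, f (T.depth v + i) : ℝ) : ℂ) else 0 := by
  induction k generalizing u v with
  | zero => simpa using inner_evec_evec u v
  | succ k ih =>
    simp only [pow_succ, mul_apply_eq_comp, hA, map_sum, map_smul, sum_inner,
      inner_sum, inner_smul_left, inner_smul_right, ih, Complex.conj_ofReal]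
    split_ifs with huv
    · subst huv
      have key : ∀ j ∈ T.chiFin hT u, ((w u : ℂ) * ∑ i ∈ T.chiFin hT u, (w u : ℂ) *
          if i = j then ((∏ l ∈ Finset.range k, f (T.depth j + l) : ℝ) : ℂ) else 0) =
          ((w u ^ 2 * ∏ l ∈ Finset.range k, f (T.depth u + (l + 1)) : ℝ) : ℂ) := by
        intro j hj
        simp only [mul_ite, mul_zero, Finset.sum_ite_eq', hj, if_true,
          T.depth_of_edge ((T.mem_chiFin hT).1 hj), add_assoc, add_comm 1]
        push_cast
        ring
      rw [Finset.sum_congr rfl key, Finset.sum_const, nsmul_eq_mul, Finset.prod_range_succ',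
        add_zero, ← hw u]
      push_cast
      ring
    · refine Finset.sum_eq_zero fun j hj => mul_eq_zero_of_right _ ?_
      refine Finset.sum_eq_zero fun i hi => ?_
      have hne : i ≠ j := by
        rintro rfl
        exact huv (T.uniq_parent ((T.mem_chiFin hT).1 hi) ((T.mem_chiFin hT).1 hj))
      simp [hne]

theorem norm_sq_shift_pow_evec (hT : T.LocFin) {A : l2 V →L[ℂ] l2 V} {w : V → ℝ} {f : ℕ → ℝ}
    (hA : ∀ v, A (evec v) = ∑ u ∈ T.chiFin hT v, (w v : ℂ) • evec u)
    (hw : ∀ v, (T.chiFin hT v).card * w v ^ 2 = f (T.depth v)) (k : ℕ) (v : V) :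
    ‖(A ^ k) (evec v)‖ ^ 2 = ∏ i ∈ Finset.range k, f (T.depth v + i) := by
  have h := T.inner_shift_pow_evec hT hA hw k v v
  rw [if_pos rfl, inner_self_eq_norm_sq_to_K, ← RCLike.ofReal_pow] at h
  exact Complex.ofReal_injective h

theorem adjoint_mul_self_apply (hT : T.LocFin) {A : l2 V →L[ℂ] l2 V} {w : V → ℝ} {f : ℕ → ℝ}
    (hA : ∀ v, A (evec v) = ∑ u ∈ T.chiFin hT v, (w v : ℂ) • evec u)
    (hw : ∀ v, (T.chiFin hT v).card * w v ^ 2 = f (T.depth v)) (x : l2 V) (v : V) :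
    (adjoint A * A) x v = f (T.depth v) * x v := by
  have hv : (adjoint A * A) (evec v) = (f (T.depth v) : ℂ) • evec v := by
    apply lp.ext
    funext u
    rw [← inner_evec_left, ← inner_evec_left, inner_smul_right, inner_evec_evec,
      mul_apply_eq_comp, adjoint_inner_right]
    simpa using T.inner_shift_pow_evec hT hA hw 1 u v
  rw [← inner_evec_left, mul_apply_eq_comp, adjoint_inner_right,
    ← adjoint_inner_left, ← mul_apply_eq_comp, hv, inner_smul_left, inner_evec_left,
    Complex.conj_ofReal]

end DirTree

/-- A bounded operator acting on `ℓ²` as pointwise multiplication by a function of modulus at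
least one is invertible. -/
theorem isUnit_of_apply_eq_mul {V : Type} {B : l2 V →L[ℂ] l2 V} {g : V → ℂ}
    (hB : ∀ x v, B x v = g v * x v) (hg : ∀ v, 1 ≤ ‖g v‖) : IsUnit B := by
  have hg0 : ∀ v, g v ≠ 0 := fun v h => by simpa [h] using (hg v).trans_lt' zero_lt_one
  rw [isUnit_iff_bijective]
  refine ⟨fun x y hxy => lp.ext (funext fun v => mul_left_cancel₀ (hg0 v) ?_), fun y => ?_⟩
  · rw [← hB, ← hB, hxy]
  · have hmem : Memℓp (fun v => (g v)⁻¹ * y v) 2 := by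
      refine memℓp_gen (((lp.memℓp y).summable (by simp)).of_nonneg_of_le
        (fun v => by positivity) fun v => ?_)
      gcongr
      rw [norm_mul, norm_inv]
      exact mul_le_of_le_one_left (norm_nonneg _) (inv_le_one_of_one_le₀ (hg v))
    refine ⟨⟨_, hmem⟩, lp.ext (funext fun v => ?_)⟩
    rw [hB]
    exact mul_inv_cancel_left₀ (hg0 v) _

/-- The Cauchy dual of a shift with weights `w` has weights `w v / f (depth v)`. -/
theorem DirTree.cauchyDual_evec {V : Type} (T : DirTree V) (hT : T.LocFin) {A : l2 V →L[ℂ] l2 V} {w : V → ℝ} {f : ℕ → ℝ}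
    (hA : ∀ v, A (evec v) = ∑ u ∈ T.chiFin hT v, (w v : ℂ) • evec u)
    (hw : ∀ v, (T.chiFin hT v).card * w v ^ 2 = f (T.depth v)) (hf : ∀ n, 1 ≤ f n) (v : V) :
    cauchyDual A (evec v) =
      ∑ u ∈ T.chiFin hT v, ((w v / f (T.depth v) : ℝ) : ℂ) • evec u := by
  have hB := T.adjoint_mul_self_apply hT hA hw
  have hunit : IsUnit (adjoint A * A) := by
    refine isUnit_of_apply_eq_mul hB fun v => ?_
    rw [Complex.norm_real]
    exact (hf _).trans (le_abs_self _)
  have hf0 : (f (T.depth v) : ℂ) ≠ 0 := by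
    exact_mod_cast (zero_lt_one.trans_le (hf _)).ne'
  have hv : (adjoint A * A) ((f (T.depth v) : ℂ)⁻¹ • evec v) = evec v := by
    apply lp.ext
    funext u
    rw [hB, lp.coeFn_smul, Pi.smul_apply, smul_eq_mul]
    by_cases huv : u = v
    · subst huv
      exact mul_inv_cancel_left₀ hf0 _
    · have h0 : evec v u = 0 := by rw [← inner_evec_left, inner_evec_evec, if_neg huv]
      simp [h0]
  have hinv : Ring.inverse (adjoint A * A) (evec v) = (f (T.depth v) : ℂ)⁻¹ • evec v := by
    conv_lhs => rw [← hv]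
    rw [← mul_apply_eq_comp, Ring.inverse_mul_cancel _ hunit, one_apply_eq_self]
  rw [cauchyDual, mul_apply_eq_comp, hinv, map_smul, hA, Finset.smul_sum]
  refine Finset.sum_congr rfl fun u _ => ?_
  rw [smul_smul]
  push_cast
  rw [div_eq_inv_mul]

theorem DirTree.card_mul_wt_sq {V : Type} (T : DirTree V) (hL : T.Leafless) (hT : T.LocFin) {q : ℝ} (hq : 1 ≤ q) (v : V) :
    (T.chiFin hT v).card * T.wt hT q v ^ 2 = ((T.depth v : ℝ) + q) / ((T.depth v : ℝ) + 1) := by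
  have hc : ((T.chiFin hT v).card : ℝ) ≠ 0 := by
    obtain ⟨u, hu⟩ := hL v
    exact_mod_cast (Finset.card_pos.2 ⟨u, (T.mem_chiFin hT).2 hu⟩).ne'
  rw [wt, div_pow, Real.sq_sqrt (by positivity), Real.sq_sqrt (by positivity),
    mul_div_cancel₀ _ hc]

theorem poch_div_poch (n : ℕ) (a b : ℝ) (k : ℕ) :
    poch (n + a) k / poch (n + b) k =
      ∏ i ∈ Finset.range k, (((n + i : ℕ) : ℝ) + a) / (((n + i : ℕ) : ℝ) + b) := by
  simp only [poch, ← Finset.prod_div_distrib, Nat.cast_add, add_right_comm]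

theorem stmt_3 {V : Type} [Countable V] [Infinite V] (T : DirTree V)
    (hL : T.Leafless) (hT : T.LocFin) (q : ℝ) (hq : 1 ≤ q)
    (S : l2 V →L[ℂ] l2 V) (hS : T.IsDirichletShift hT q S) :
    ∀ (k : ℕ) (v : V),
      ‖(S ^ k) (evec v)‖ ^ 2
          = poch ((T.depth v : ℝ) + q) k / poch ((T.depth v : ℝ) + 1) k ∧
      ‖(cauchyDual S ^ k) (evec v)‖ ^ 2
          = poch ((T.depth v : ℝ) + 1) k / poch ((T.depth v : ℝ) + q) k := by
  intro k v
  have hw := T.card_mul_wt_sq hL hT hq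
  have hf : ∀ n : ℕ, 1 ≤ ((n : ℝ) + q) / ((n : ℝ) + 1) := fun n => by
    rw [one_le_div (by positivity)]
    linarith
  have hS' := T.cauchyDual_evec hT (f := fun n => ((n : ℝ) + q) / ((n : ℝ) + 1)) hS hw hf
  rw [poch_div_poch, poch_div_poch]
  refine ⟨T.norm_sq_shift_pow_evec hT
    (f := fun n => ((n : ℝ) + q) / ((n : ℝ) + 1)) hS hw k v, ?_⟩
  refine T.norm_sq_shift_pow_evec hT (f := fun n => ((n : ℝ) + 1) / ((n : ℝ) + q)) hS'
    (fun u => ?_) k v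
  have h1 : (T.depth u : ℝ) + 1 ≠ 0 := by positivity
  have h2 : (T.depth u : ℝ) + q ≠ 0 := by positivity
  rw [div_pow, mul_div_assoc', hw u]
  field_simp

end
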